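/- Let f ∈ C²(ℝⁿ) have compact support. Then lim_{t→0⁺} (1/√t) ∫_{ℝⁿ} ∫_{ℝⁿ} |f(x) − f(y)| (4πt)^{-n/2} e^{-|x−y|²/(4t)} dy dx = (2/√π) ∫_{ℝⁿ} |∇f(x)| dx. -/

import Mathlib

open Real MeasureTheory Filter Topology

/-- The Gaussian weight with variance parameter normalised at time one. -/
noncomputable def hsG (n : ℕ) (z : EuclideanSpace ℝ (Fin n)) : ℝ :=
  (4 * π) ^ (-(n : ℝ) / 2) * Real.exp (-‖z‖ ^ 2 / 4)

lemma hsG_nonneg (n : ℕ) (z : EuclideanSpace ℝ (Fin n)) : 0 ≤ hsG n z := by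
  unfold hsG; positivity

lemma hsG_cont (n : ℕ) : Continuous (hsG n) := by
  unfold hsG; fun_prop

lemma hsG_integrable (n : ℕ) :
    Integrable (fun z : EuclideanSpace ℝ (Fin n) => ‖z‖ * hsG n z) := by
  have h := (GaussianFourier.integrable_cexp_neg_mul_sq_norm_add (V := EuclideanSpace ℝ (Fin n))
    (b := (1 / 8 : ℂ)) (by norm_num) 0 0).norm
  have h2 := h.const_mul ((4 * π) ^ (-(n : ℝ) / 2) * 2)
  refine h2.mono' ?_ (ae_of_all _ fun z => ?_)
  · exact (continuous_norm.mul (hsG_cont n)).aestronglyMeasurable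
  · have e1 : ‖Complex.exp (-(1 / 8 : ℂ) * (‖z‖ : ℂ) ^ 2 + 0 * ((inner ℝ (0 : EuclideanSpace ℝ (Fin n)) z : ℝ) : ℂ))‖
        = Real.exp (-‖z‖ ^ 2 / 8) := by
      rw [Complex.norm_exp]
      congr 1
      have : (-(1 / 8 : ℂ) * (‖z‖ : ℂ) ^ 2 + 0 * ((inner ℝ (0 : EuclideanSpace ℝ (Fin n)) z : ℝ) : ℂ))
        = ((-‖z‖ ^ 2 / 8 : ℝ) : ℂ) := by push_cast; ring
      rw [this, Complex.ofReal_re]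
    rw [e1, Real.norm_of_nonneg (mul_nonneg (norm_nonneg _) (hsG_nonneg n z)), hsG]
    have e2 : Real.exp (-‖z‖ ^ 2 / 8) = Real.exp (-‖z‖ ^ 2 / 4) * Real.exp (‖z‖ ^ 2 / 8) := by
      rw [← Real.exp_add]; congr 1; ring
    have e3 : ‖z‖ ≤ 2 * Real.exp (‖z‖ ^ 2 / 8) := by
      nlinarith [Real.add_one_le_exp (‖z‖ ^ 2 / 8), sq_nonneg (‖z‖ - 4)]
    rw [e2]
    have : 0 ≤ (4 * π) ^ (-(n : ℝ) / 2) * Real.exp (-‖z‖ ^ 2 / 4) := hsG_nonneg n z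
    nlinarith

lemma hs_swap_integrable (n : ℕ) (Φ : EuclideanSpace ℝ (Fin n) → EuclideanSpace ℝ (Fin n) → ℝ)
    (hc : Continuous (Function.uncurry Φ)) (h0 : ∀ x z, 0 ≤ Φ x z)
    (hi : ∀ z, Integrable (fun x => Φ x z)) (C : ℝ) (hb : ∀ z, ∫ x, Φ x z ≤ C * ‖z‖) :
    ∫ x, ∫ z, Φ x z * hsG n z = ∫ z, (∫ x, Φ x z) * hsG n z := by
  have hcont : Continuous (Function.uncurry fun x z => Φ x z * hsG n z) := by
    have := (hsG_cont n).comp (continuous_snd (X := EuclideanSpace ℝ (Fin n)))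
    exact hc.mul this
  rw [integral_integral_swap]
  · simp_rw [integral_mul_const]
  · rw [integrable_prod_iff' hcont.aestronglyMeasurable]
    refine ⟨ae_of_all _ fun z => (hi z).mul_const (hsG n z), ?_⟩
    refine ((hsG_integrable n).const_mul C).mono' ?_ (ae_of_all _ fun z => ?_)
    · exact (hcont.norm.aestronglyMeasurable
        (μ := (volume : Measure (EuclideanSpace ℝ (Fin n))).prod volume)).prod_swap.integral_prod_right'
    · have : ∀ x, ‖Function.uncurry (fun x z => Φ x z * hsG n z) (x, z)‖ = Φ x z * hsG n z :=
        fun x => Real.norm_of_nonneg (mul_nonneg (h0 x z) (hsG_nonneg n z))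
      simp_rw [this]
      rw [integral_mul_const, Real.norm_of_nonneg
        (mul_nonneg (integral_nonneg fun x => h0 x z) (hsG_nonneg n z)), ← mul_assoc]
      exact mul_le_mul_of_nonneg_right (hb z) (hsG_nonneg n z)

lemma hs_cov (n : ℕ) (f : EuclideanSpace ℝ (Fin n) → ℝ) (t : ℝ) (ht : 0 < t)
    (x : EuclideanSpace ℝ (Fin n)) :
    ∫ y : EuclideanSpace ℝ (Fin n), |f x - f y| * ((4 * π * t) ^ (-(n : ℝ) / 2)
              * Real.exp (-‖x - y‖ ^ 2 / (4 * t)))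
      = ∫ z, |f (x + √t • z) - f x| * hsG n z := by
  have hs : 0 < √t := Real.sqrt_pos.2 ht
  rw [← integral_add_left_eq_self _ x]
  set F : EuclideanSpace ℝ (Fin n) → ℝ := fun y => |f x - f (x + y)| * ((4 * π * t) ^ (-(n : ℝ) / 2)
              * Real.exp (-‖x - (x + y)‖ ^ 2 / (4 * t))) with hF
  have h := Measure.integral_comp_smul (volume : Measure (EuclideanSpace ℝ (Fin n))) F (√t)
  rw [finrank_euclideanSpace_fin, abs_of_nonneg (by positivity), smul_eq_mul] at h
  have h' : ∫ y, F y = (√t) ^ n * ∫ z, F (√t • z) := by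
    rw [h, ← mul_assoc, mul_inv_cancel₀ (by positivity), one_mul]
  rw [h', ← integral_const_mul]
  congr 1
  ext z
  have e1 : (√t) ^ n * t ^ (-(n : ℝ) / 2) = 1 := by
    rw [Real.sqrt_eq_rpow, ← Real.rpow_natCast, ← Real.rpow_mul ht.le, ← Real.rpow_add ht]
    rw [show 1 / 2 * (n : ℝ) + -(n : ℝ) / 2 = 0 by ring, Real.rpow_zero]
  have e2 : -‖x - (x + √t • z)‖ ^ 2 / (4 * t) = -‖z‖ ^ 2 / 4 := by
    rw [show x - (x + √t • z) = -(√t • z) by abel, norm_neg, norm_smul, Real.norm_of_nonneg hs.le,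
      mul_pow, Real.sq_sqrt ht.le]
    field_simp
  simp only [hF, hsG]
  rw [e2, Real.mul_rpow (by positivity) ht.le, abs_sub_comm]
  linear_combination (|f (x + √t • z) - f x| * ((4 * π) ^ (-(n : ℝ) / 2) * Real.exp (-‖z‖ ^ 2 / 4))) * e1

lemma hs_abs_gauss : ∫ x : ℝ, |x| * Real.exp (-x ^ 2 / 4) = 4 := by
  have h := integral_comp_abs (f := fun x : ℝ => x * Real.exp (-x ^ 2 / 4))
  simp only [sq_abs] at h
  rw [h]
  have h2 := integral_rpow_mul_exp_neg_mul_rpow (p := 2) (q := 1) (b := 1 / 4)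
    (by norm_num) (by norm_num) (by norm_num)
  have h3 : ∫ x in Set.Ioi (0 : ℝ), x * Real.exp (-x ^ 2 / 4) =
      ∫ x in Set.Ioi (0 : ℝ), x ^ (1 : ℝ) * Real.exp (-(1 / 4) * x ^ (2 : ℝ)) := by
    congr 1
    ext x
    rw [Real.rpow_one, Real.rpow_two]
    congr 2; ring
  rw [h3, h2]
  norm_num

lemma hs_gauss : ∫ x : ℝ, Real.exp (-x ^ 2 / 4) = √(4 * π) := by
  have h := integral_gaussian (1 / 4)
  rw [show π / (1 / 4) = 4 * π by ring] at h
  rw [← h]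
  congr 1; ext x; congr 1; ring

lemma hs_moment (n : ℕ) (hn : 1 ≤ n) (l : EuclideanSpace ℝ (Fin n) →L[ℝ] ℝ) :
    ∫ z, |l z| * hsG n z = 2 / √π * ‖l‖ := by
  obtain ⟨m, rfl⟩ : ∃ m, n = m + 1 := ⟨n - 1, by omega⟩
  set v := (InnerProductSpace.toDual ℝ (EuclideanSpace ℝ (Fin (m + 1)))).symm l with hv
  have hl : ∀ z, l z = inner ℝ v z := fun z => by rw [hv, InnerProductSpace.toDual_symm_apply]
  have hln : ‖l‖ = ‖v‖ := by rw [hv, LinearIsometryEquiv.norm_map]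
  clear_value v
  by_cases hv0 : v = 0
  · simp [hl, hln, hv0]
  have hvn : ‖v‖ ≠ 0 := norm_ne_zero_iff.2 hv0
  obtain ⟨b, hb⟩ := Orthonormal.exists_orthonormalBasis_extension_of_card_eq (𝕜 := ℝ)
    (E := EuclideanSpace ℝ (Fin (m + 1))) (ι := Fin (m + 1)) (by simp)
    (v := fun _ => (‖v‖⁻¹ : ℝ) • v) (s := {0}) (by
      rw [orthonormal_iff_ite]
      rintro ⟨i, hi⟩ ⟨j, hj⟩
      simp only [Set.mem_singleton_iff] at hi hj
      subst hi; subst hj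
      simp only [Set.domRestrict, inner_smul_left, inner_smul_right, real_inner_self_eq_norm_sq]
      simp
      field_simp)
  have hb0 : b 0 = (‖v‖⁻¹ : ℝ) • v := hb 0 rfl
  have hvb : v = ‖v‖ • b 0 := by rw [hb0, smul_smul, mul_inv_cancel₀ hvn, one_smul]
  rw [← b.measurePreserving_repr_symm.integral_comp
    b.repr.symm.toHomeomorph.measurableEmbedding]
  rw [← (PiLp.volume_preserving_toLp (Fin (m + 1))).integral_comp
    (MeasurableEquiv.toLp 2 _).measurableEmbedding]
  have key : ∀ w : Fin (m + 1) → ℝ,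
      |l (b.repr.symm (WithLp.toLp 2 w))| * hsG (m + 1) (b.repr.symm (WithLp.toLp 2 w))
      = ((4 * π) ^ (-((m + 1 : ℕ) : ℝ) / 2) * ‖v‖) *
        ∏ i, (if i = 0 then fun x : ℝ => |x| * Real.exp (-x ^ 2 / 4)
          else fun x : ℝ => Real.exp (-x ^ 2 / 4)) (w i) := by
    intro w
    have e1 : l (b.repr.symm (WithLp.toLp 2 w)) = ‖v‖ * w 0 := by
      rw [hl]
      conv_lhs => rw [hvb]
      rw [inner_smul_left, ← b.repr_apply_apply]
      simp
    rw [e1, hsG, LinearIsometryEquiv.norm_map, EuclideanSpace.norm_sq_eq, Fin.prod_univ_succ,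
      Fin.sum_univ_succ]
    simp only [if_true, Fin.succ_ne_zero, if_false, ← Real.exp_sum]
    rw [abs_mul, abs_norm]
    have : Real.exp (-(‖w 0‖ ^ 2 + ∑ i : Fin m, ‖w i.succ‖ ^ 2) / 4)
      = Real.exp (-(w 0) ^ 2 / 4) * Real.exp (∑ i : Fin m, -(w i.succ) ^ 2 / 4) := by
      rw [← Real.exp_add, ← Finset.sum_div, Finset.sum_neg_distrib]
      simp only [Real.norm_eq_abs, sq_abs]
      congr 1; ring
    rw [this]; ring
  simp_rw [key]
  rw [integral_const_mul, integral_fintype_prod_volume_eq_prod, Fin.prod_univ_succ]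
  simp only [if_true, Fin.succ_ne_zero, if_false, hs_abs_gauss, hs_gauss]
  rw [Finset.prod_const, Finset.card_univ, Fintype.card_fin, hln]
  have hp : (0 : ℝ) < 4 * π := by positivity
  have e1 : (4 * π) ^ (-((m + 1 : ℕ) : ℝ) / 2) * (√(4 * π)) ^ m = (√(4 * π))⁻¹ := by
    rw [Real.sqrt_eq_rpow, ← Real.rpow_natCast, ← Real.rpow_mul hp.le, ← Real.rpow_add hp,
      ← Real.rpow_neg hp.le]
    congr 1; push_cast; ring
  have e2 : √(4 * π) = 2 * √π := by
    rw [Real.sqrt_mul (by norm_num), show (4 : ℝ) = 2 ^ 2 by norm_num, Real.sqrt_sq (by norm_num)]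
  have e3 : (√(4 * π))⁻¹ * 4 = 2 / √π := by
    rw [e2]; have := Real.sqrt_pos.2 Real.pi_pos; field_simp; norm_num
  rw [← e3]
  linear_combination (‖v‖ * 4) * e1

lemma hs_diff_bound (n : ℕ) (f : EuclideanSpace ℝ (Fin n) → ℝ) (L : NNReal)
    (hL : LipschitzWith L f) (hsupp : HasCompactSupport f) (h : EuclideanSpace ℝ (Fin n)) :
    ∫ x, |f (x + h) - f x| ≤ (2 * L * volume.real (tsupport f)) * ‖h‖ := by
  have hm : MeasurableSet (tsupport f) := (isClosed_tsupport f).measurableSet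
  have hfin : volume (tsupport f) ≠ ⊤ := hsupp.isCompact.measure_lt_top.ne
  have hI : Integrable ((tsupport f).indicator fun _ => (L * ‖h‖ : ℝ)) := by
    rw [integrable_indicator_iff hm]; exact integrableOn_const hfin
  have hI2 : Integrable (fun x => (tsupport f).indicator (fun _ => (L * ‖h‖ : ℝ)) (x + h)) :=
    hI.comp_add_right h
  have hval : ∫ x, (tsupport f).indicator (fun _ => (L * ‖h‖ : ℝ)) x
      = volume.real (tsupport f) * (L * ‖h‖) := by
    rw [integral_indicator hm, setIntegral_const, smul_eq_mul]
  calc ∫ x, |f (x + h) - f x|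
      ≤ ∫ x, ((tsupport f).indicator (fun _ => (L * ‖h‖ : ℝ)) (x + h)
          + (tsupport f).indicator (fun _ => (L * ‖h‖ : ℝ)) x) := by
        refine integral_mono_of_nonneg (ae_of_all _ fun x => abs_nonneg _) (hI2.add hI)
          (ae_of_all _ fun x => ?_)
        have hlip : |f (x + h) - f x| ≤ L * ‖h‖ := by
          have := hL.dist_le_mul (x + h) x
          simpa [Real.dist_eq] using this
        have hp : (0 : ℝ) ≤ L * ‖h‖ := by positivity
        by_cases h1 : x + h ∈ tsupport f <;> by_cases h2 : x ∈ tsupport f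
        · simp [h1, h2]; linarith
        · simp [h1, h2]; simpa using hlip
        · simp [h1, h2]; simpa using hlip
        · simp [h1, h2, image_eq_zero_of_notMem_tsupport h1, image_eq_zero_of_notMem_tsupport h2]
    _ = (2 * L * volume.real (tsupport f)) * ‖h‖ := by
        rw [integral_add hI2 hI, integral_add_right_eq_self
          (fun x => (tsupport f).indicator (fun _ => (L * ‖h‖ : ℝ)) x), hval]
        ring

lemma hs_inner_lim (n : ℕ) (f : EuclideanSpace ℝ (Fin n) → ℝ) (hf : ContDiff ℝ 2 f) (L : NNReal)
    (hL : LipschitzWith L f) (hsupp : HasCompactSupport f) (z : EuclideanSpace ℝ (Fin n)) :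
    Tendsto (fun s : ℝ => ∫ x, s⁻¹ * |f (x + s • z) - f x|) (𝓝[>] 0)
      (𝓝 (∫ x, |fderiv ℝ f x z|)) := by
  have hcf := hf.continuous
  let K := Metric.cthickening ‖z‖ (tsupport f)
  have hK : IsCompact K := hsupp.isCompact.cthickening
  refine tendsto_integral_filter_of_dominated_convergence
    (K.indicator fun _ => (L * ‖z‖ : ℝ)) ?_ ?_ ?_ ?_
  · exact Eventually.of_forall fun s => Continuous.aestronglyMeasurable (by fun_prop)
  · filter_upwards [Ioc_mem_nhdsGT (zero_lt_one (α := ℝ))] with s hs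
    refine ae_of_all _ fun x => ?_
    have hs0 : 0 < s := hs.1
    rw [Real.norm_of_nonneg (by positivity)]
    by_cases hx : x ∈ K
    · rw [Set.indicator_of_mem hx]
      have := hL.dist_le_mul (x + s • z) x
      rw [Real.dist_eq, dist_self_add_left, norm_smul, Real.norm_of_nonneg hs0.le] at this
      rw [inv_mul_le_iff₀ hs0]; linarith
    · have h1 : f x = 0 := by
        refine image_eq_zero_of_notMem_tsupport fun h => hx ?_
        exact Metric.self_subset_cthickening _ h
      have h2 : f (x + s • z) = 0 := by
        refine image_eq_zero_of_notMem_tsupport fun h => hx ?_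
        refine Metric.mem_cthickening_of_dist_le x (x + s • z) _ _ h ?_
        rw [dist_self_add_right, norm_smul, Real.norm_of_nonneg hs0.le]
        nlinarith [hs.2, norm_nonneg z]
      simp [h1, h2, hx]
  · rw [integrable_indicator_iff hK.measurableSet]
    exact integrableOn_const hK.measure_lt_top.ne
  · refine ae_of_all _ fun x => ?_
    have hd : HasFDerivAt f (fderiv ℝ f x) x :=
      (hf.differentiable (by norm_num) x).hasFDerivAt
    have h := (hd.hasLineDerivAt z).tendsto_slope_zero_right.abs
    refine h.congr' ?_
    filter_upwards [self_mem_nhdsWithin] with s (hs : 0 < s)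
    rw [smul_eq_mul, abs_mul, abs_of_pos (inv_pos.2 hs)]

theorem heat_semigroup_smooth_case (n : ℕ) (hn : 1 ≤ n)
    (f : EuclideanSpace ℝ (Fin n) → ℝ)
    (hf : ContDiff ℝ 2 f) (hsupp : HasCompactSupport f) :
    Tendsto (fun t : ℝ =>
        (1 / Real.sqrt t) *
          ∫ x : EuclideanSpace ℝ (Fin n), ∫ y : EuclideanSpace ℝ (Fin n),
            |f x - f y| * ((4 * π * t) ^ (-(n : ℝ) / 2)
              * Real.exp (-‖x - y‖ ^ 2 / (4 * t))))
      (𝓝[>] 0)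
      (𝓝 (2 / Real.sqrt π * ∫ x : EuclideanSpace ℝ (Fin n), ‖fderiv ℝ f x‖)) := by
  obtain ⟨L, hL⟩ := ContDiff.lipschitzWith_of_hasCompactSupport hsupp hf (by norm_num)
  have hcf := hf.continuous
  have hcd : Continuous (fderiv ℝ f) := hf.continuous_fderiv (by norm_num)
  have hsd : HasCompactSupport (fderiv ℝ f) := hsupp.fderiv ℝ
  have hintd : Integrable (fun x => ‖fderiv ℝ f x‖) :=
    hcd.norm.integrable_of_hasCompactSupport hsd.norm
  have hintz : ∀ z, Integrable (fun x => |fderiv ℝ f x z|) := fun z => by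
    refine (hintd.mul_const ‖z‖).mono' (Continuous.aestronglyMeasurable (by fun_prop))
      (ae_of_all _ fun x => ?_)
    rw [Real.norm_eq_abs, abs_abs]
    exact (fderiv ℝ f x).le_opNorm z
  -- the limit
  have hlim : 2 / Real.sqrt π * ∫ x : EuclideanSpace ℝ (Fin n), ‖fderiv ℝ f x‖
      = ∫ z, (∫ x, |fderiv ℝ f x z|) * hsG n z := by
    rw [← hs_swap_integrable n (fun x z => |fderiv ℝ f x z|) ?_ (fun x z => abs_nonneg _) hintz
      (∫ x, ‖fderiv ℝ f x‖) ?_]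
    · simp_rw [hs_moment n hn]
      rw [integral_const_mul]
    · have : Continuous fun p : EuclideanSpace ℝ (Fin n) × EuclideanSpace ℝ (Fin n) =>
          fderiv ℝ f p.1 p.2 := (hcd.comp continuous_fst).clm_apply continuous_snd
      exact this.abs
    · intro z
      rw [← integral_mul_const]
      exact integral_mono (hintz z) (hintd.mul_const _) fun x => (fderiv ℝ f x).le_opNorm z
  have hintdiff : ∀ h, Integrable (fun x => |f (x + h) - f x|) := fun h => by
    have h1 : Integrable f := hcf.integrable_of_hasCompactSupport hsupp
    exact ((h1.comp_add_right h).sub h1).abs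
  have hbd : ∀ s : ℝ, 0 < s → ∀ z, ∫ x, s⁻¹ * |f (x + s • z) - f x|
      ≤ (2 * L * volume.real (tsupport f)) * ‖z‖ := by
    intro s hs z
    rw [integral_const_mul, inv_mul_le_iff₀ hs]
    have := hs_diff_bound n f L hL hsupp (s • z)
    rw [norm_smul, Real.norm_of_nonneg hs.le] at this
    linarith
  rw [hlim]
  have hmain : Tendsto (fun s : ℝ => ∫ z, (∫ x, s⁻¹ * |f (x + s • z) - f x|) * hsG n z) (𝓝[>] 0)
      (𝓝 (∫ z, (∫ x, |fderiv ℝ f x z|) * hsG n z)) := by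
    refine tendsto_integral_filter_of_dominated_convergence
      (fun z => (2 * L * volume.real (tsupport f)) * (‖z‖ * hsG n z)) ?_ ?_
      ((hsG_integrable n).const_mul _) ?_
    · refine Eventually.of_forall fun s => ?_
      have hc : Continuous fun p : EuclideanSpace ℝ (Fin n) × EuclideanSpace ℝ (Fin n) =>
          s⁻¹ * |f (p.2 + s • p.1) - f p.2| := by fun_prop
      exact (hc.aestronglyMeasurable
        (μ := (volume : Measure (EuclideanSpace ℝ (Fin n))).prod volume)).integral_prod_right'.mul
        (hsG_cont n).aestronglyMeasurable
    · filter_upwards [self_mem_nhdsWithin] with s (hs : 0 < s)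
      refine ae_of_all _ fun z => ?_
      rw [Real.norm_of_nonneg (mul_nonneg (integral_nonneg fun x => by positivity)
        (hsG_nonneg n z)), ← mul_assoc]
      exact mul_le_mul_of_nonneg_right (hbd s hs z) (hsG_nonneg n z)
    · exact ae_of_all _ fun z => (hs_inner_lim n f hf L hL hsupp z).mul_const _
  have hsqrt : Tendsto Real.sqrt (𝓝[>] 0) (𝓝[>] 0) := by
    refine tendsto_nhdsWithin_iff.2 ⟨?_, ?_⟩
    · have := Real.continuous_sqrt.tendsto 0
      rw [Real.sqrt_zero] at this
      exact this.mono_left nhdsWithin_le_nhds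
    · filter_upwards [self_mem_nhdsWithin] with t (ht : 0 < t)
      exact Real.sqrt_pos.2 ht
  refine (hmain.comp hsqrt).congr' ?_
  filter_upwards [self_mem_nhdsWithin] with t (ht : 0 < t)
  have hs : 0 < √t := Real.sqrt_pos.2 ht
  simp_rw [hs_cov n f t ht]
  simp only [Function.comp]
  rw [← hs_swap_integrable n (fun x z => (√t)⁻¹ * |f (x + √t • z) - f x|) ?_ ?_ ?_ _ (hbd _ hs)]
  · simp_rw [mul_assoc, integral_const_mul, one_div]
  · simp only [Function.uncurry_def]; fun_prop
  · intro x z; positivity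
  · intro z; exact (hintdiff _).const_mul _
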